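/- arXiv:2401.05816 — 2 statements merged into one kernel-verified Lean document; each statement's English description precedes it below -/
import Mathlib

section
/- Fix an integer e ≥ 2 and κ = (κ₁, κ₂) ∈ (ℤ/eℤ)². Suppose λ and μ are bipartitions with μ → λ (that is, μ is obtained from λ by removing the good i-node for some i ∈ ℤ/eℤ), and let a ∈ {1,2}. Then λ⁽ᵃ⁾ is e-restricted if and only if μ⁽ᵃ⁾ is e-restricted. -/
namespace Wt3

/-- `f : ℕ → ℕ` (0-indexed: `f r` is the `(r+1)`-th part `λ_{r+1}`) is a partition if it is
weakly decreasing with finitely many nonzero terms. -/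
def IsPartition (f : ℕ → ℕ) : Prop :=
  (∀ r, f (r + 1) ≤ f r) ∧ ∃ N, ∀ r, N ≤ r → f r = 0

/-- A bipartition: an ordered pair of partitions, given as `lam : Fin 2 → ℕ → ℕ`. -/
def IsBipartition (lam : Fin 2 → ℕ → ℕ) : Prop := ∀ a, IsPartition (lam a)

/-- Nodes `(r, c, a)` with 0-indexed row `r`, column `c`, and component `a : Fin 2`. -/
abbrev Node := ℕ × ℕ × Fin 2

/-- The Young diagram of a bipartition: `(r,c,a)` is a node iff `c < λ⁽ᵃ⁾_r` (0-indexed,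
corresponding to `c+1 ≤ λ⁽ᵃ⁾_{r+1}` in 1-indexed terms). -/
def Diagram (lam : Fin 2 → ℕ → ℕ) : Set Node := {x | x.2.1 < lam x.2.2 x.1}

/-- A node of `[λ]` is removable if deleting it leaves the Young diagram of a bipartition. -/
def IsRemovable (lam : Fin 2 → ℕ → ℕ) (x : Node) : Prop :=
  x ∈ Diagram lam ∧ ∃ mu, IsBipartition mu ∧ Diagram mu = Diagram lam \ {x}

/-- A node not in `[λ]` is addable if adding it gives the Young diagram of a bipartition. -/
def IsAddable (lam : Fin 2 → ℕ → ℕ) (x : Node) : Prop :=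
  x ∉ Diagram lam ∧ ∃ mu, IsBipartition mu ∧ Diagram mu = Diagram lam ∪ {x}

/-- The residue `c − r + κ_a ∈ ℤ/eℤ` of a node `(r,c,a)` (0-indexing leaves this unchanged). -/
def res (e : ℕ) (κ : Fin 2 → ZMod e) (x : Node) : ZMod e :=
  (x.2.1 : ZMod e) - (x.1 : ZMod e) + κ x.2.2

/-- `c_i(λ)`: the number of `i`-nodes of `λ`. -/
noncomputable def cnt (e : ℕ) (κ : Fin 2 → ZMod e) (lam : Fin 2 → ℕ → ℕ) (i : ZMod e) : ℕ :=
  Set.ncard {x : Node | x ∈ Diagram lam ∧ res e κ x = i}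

/-- The number of removable `i`-nodes of `λ`. -/
noncomputable def remCount (e : ℕ) (κ : Fin 2 → ZMod e) (lam : Fin 2 → ℕ → ℕ) (i : ZMod e) : ℕ :=
  Set.ncard {x : Node | IsRemovable lam x ∧ res e κ x = i}

/-- The number of addable `i`-nodes of `λ`. -/
noncomputable def addCount (e : ℕ) (κ : Fin 2 → ZMod e) (lam : Fin 2 → ℕ → ℕ) (i : ZMod e) : ℕ :=
  Set.ncard {x : Node | IsAddable lam x ∧ res e κ x = i}

/-- `δ_i(λ)`: number of removable `i`-nodes minus number of addable `i`-nodes. -/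
noncomputable def delta (e : ℕ) (κ : Fin 2 → ZMod e) (lam : Fin 2 → ℕ → ℕ) (i : ZMod e) : ℤ :=
  (remCount e κ lam i : ℤ) - (addCount e κ lam i : ℤ)

/-- The weight `wt(λ) = c_{κ₁}(λ) + c_{κ₂}(λ) − ½ Σ_{i ∈ ℤ/eℤ} (c_i(λ) − c_{i+1}(λ))²`. -/
noncomputable def wt (e : ℕ) (κ : Fin 2 → ZMod e) (lam : Fin 2 → ℕ → ℕ) : ℚ :=
  (cnt e κ lam (κ 0) : ℚ) + (cnt e κ lam (κ 1) : ℚ) -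
    (1 / 2) * ∑ j ∈ Finset.range e,
      ((cnt e κ lam (j : ZMod e) : ℚ) - (cnt e κ lam ((j : ZMod e) + 1) : ℚ)) ^ 2

/-- The rim of `λ`: nodes `(r,c,a) ∈ [λ]` with `(r+1,c+1,a) ∉ [λ]`. -/
def Rim (lam : Fin 2 → ℕ → ℕ) : Set Node :=
  {x | x ∈ Diagram lam ∧ (x.1 + 1, x.2.1 + 1, x.2.2) ∉ Diagram lam}

/-- One step along a strip: `y` is one step to the right of, or one step above, `x`
(in the same component). -/
def Step (x y : Node) : Prop :=
  y.2.2 = x.2.2 ∧ ((y.1 = x.1 ∧ y.2.1 = x.2.1 + 1) ∨ (x.1 = y.1 + 1 ∧ y.2.1 = x.2.1))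

/-- A rim hook of `λ`: a nonempty subset of the rim, contained in a single component,
forming a connected strip, whose removal leaves the Young diagram of a bipartition. -/
def IsRimHook (lam : Fin 2 → ℕ → ℕ) (H : Finset Node) : Prop :=
  H.Nonempty ∧ ↑H ⊆ Rim lam ∧ (∀ x ∈ H, ∀ y ∈ H, x.2.2 = y.2.2) ∧
    (∃ l : List Node, l.Chain' Step ∧ ∀ x : Node, x ∈ l ↔ x ∈ H) ∧
    ∃ mu, IsBipartition mu ∧ Diagram mu = Diagram lam \ ↑H

/-- A bicore: a bipartition with no rim `e`-hooks. -/
def IsBicore (e : ℕ) (lam : Fin 2 → ℕ → ℕ) : Prop :=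
  ¬ ∃ H : Finset Node, IsRimHook lam H ∧ H.card = e

/-- The beta-set `{λ_r + k − r : 1 ≤ r ≤ k}` of a partition with charge `k` (0-indexed form). -/
def betaSet (f : ℕ → ℕ) (k : ℕ) : Finset ℕ :=
  (Finset.range k).image fun r => f r + (k - (r + 1))

/-- The number of nonzero parts of a partition. -/
noncomputable def len (f : ℕ → ℕ) : ℕ := Set.ncard {r : ℕ | f r ≠ 0}

/-- `(k₁,k₂)` is a bicharge for `κ` relative to `λ`. -/
def IsBicharge (e : ℕ) (κ : Fin 2 → ZMod e) (lam : Fin 2 → ℕ → ℕ) (k₁ k₂ : ℕ) : Prop :=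
  (k₁ : ZMod e) = κ 0 ∧ (k₂ : ZMod e) = κ 1 ∧ len (lam 0) ≤ k₁ ∧ len (lam 1) ≤ k₂

/-- `γ_x(λ)`: beads of residue `x` in the first beta-set minus those in the second. -/
def gamma (e : ℕ) (lam : Fin 2 → ℕ → ℕ) (k₁ k₂ : ℕ) (x : ZMod e) : ℤ :=
  (((betaSet (lam 0) k₁).filter fun b : ℕ => (b : ZMod e) = x).card : ℤ) -
    (((betaSet (lam 1) k₂).filter fun b : ℕ => (b : ZMod e) = x).card : ℤ)

/-- `x` is above (higher than) `y`. -/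
def Above (x y : Node) : Prop := x.2.2 < y.2.2 ∨ (x.2.2 = y.2.2 ∧ x.1 < y.1)

/-- A normal `i`-node: a removable `i`-node `x` such that for every addable `i`-node `y`
below `x`, the removable `i`-nodes strictly between `x` and `y` outnumber the addable ones
(equivalently, the `−` sign of `x` survives in the reduced `i`-signature). -/
def IsNormal (e : ℕ) (κ : Fin 2 → ZMod e) (lam : Fin 2 → ℕ → ℕ) (i : ZMod e) (x : Node) :
    Prop :=
  IsRemovable lam x ∧ res e κ x = i ∧
    ∀ y : Node, IsAddable lam y → res e κ y = i → Above x y →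
      Set.ncard {z : Node | IsAddable lam z ∧ res e κ z = i ∧ Above x z ∧ Above z y} <
        Set.ncard {z : Node | IsRemovable lam z ∧ res e κ z = i ∧ Above x z ∧ Above z y}

/-- The good `i`-node: the highest normal `i`-node. -/
def IsGood (e : ℕ) (κ : Fin 2 → ZMod e) (lam : Fin 2 → ℕ → ℕ) (i : ZMod e) (x : Node) :
    Prop :=
  IsNormal e κ lam i x ∧ ∀ y, IsNormal e κ lam i y → y = x ∨ Above x y

/-- An antinormal `i`-node: a removable `i`-node `x` such that for every addable `i`-node `y`
above `x`, the removable `i`-nodes strictly between `y` and `x` outnumber the addable ones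
(equivalently, the `−` sign of `x` survives in the antireduced `i`-signature). -/
def IsAntinormal (e : ℕ) (κ : Fin 2 → ZMod e) (lam : Fin 2 → ℕ → ℕ) (i : ZMod e) (x : Node) :
    Prop :=
  IsRemovable lam x ∧ res e κ x = i ∧
    ∀ y : Node, IsAddable lam y → res e κ y = i → Above y x →
      Set.ncard {z : Node | IsAddable lam z ∧ res e κ z = i ∧ Above y z ∧ Above z x} <
        Set.ncard {z : Node | IsRemovable lam z ∧ res e κ z = i ∧ Above y z ∧ Above z x}

/-- The antigood `i`-node: the lowest antinormal `i`-node. -/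
def IsAntigood (e : ℕ) (κ : Fin 2 → ZMod e) (lam : Fin 2 → ℕ → ℕ) (i : ZMod e) (x : Node) :
    Prop :=
  IsAntinormal e κ lam i x ∧ ∀ y, IsAntinormal e κ lam i y → y = x ∨ Above y x

/-- `μ →ᵢ λ`: `μ` is obtained from `λ` by removing the good `i`-node. -/
def RemGoodAt (e : ℕ) (κ : Fin 2 → ZMod e) (i : ZMod e) (mu lam : Fin 2 → ℕ → ℕ) : Prop :=
  ∃ x, IsGood e κ lam i x ∧ Diagram mu = Diagram lam \ {x}

/-- `μ ⇒ᵢ λ`: `μ` is obtained from `λ` by removing the antigood `i`-node. -/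
def RemAntigoodAt (e : ℕ) (κ : Fin 2 → ZMod e) (i : ZMod e) (mu lam : Fin 2 → ℕ → ℕ) : Prop :=
  ∃ x, IsAntigood e κ lam i x ∧ Diagram mu = Diagram lam \ {x}

/-- `μ → λ`: `μ` is obtained from the bipartition `λ` by removing a good node. -/
def RemGood (e : ℕ) (κ : Fin 2 → ZMod e) (mu lam : Fin 2 → ℕ → ℕ) : Prop :=
  IsBipartition mu ∧ IsBipartition lam ∧ ∃ i, RemGoodAt e κ i mu lam

/-- A bipartition is restricted if it lies in the class of the empty bipartition under the
equivalence relation generated by `→`. -/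
def IsRestricted (e : ℕ) (κ : Fin 2 → ZMod e) (lam : Fin 2 → ℕ → ℕ) : Prop :=
  Relation.EqvGen (RemGood e κ) lam (fun _ _ => 0)

/-- A partition is `e`-restricted if `λ_r − λ_{r+1} < e` for all `r`. -/
def IsERestricted (e : ℕ) (f : ℕ → ℕ) : Prop := ∀ r, f r < f (r + 1) + e

/-- The conjugate partition: `λ′_r = #{c : λ_c ≥ r}` (0-indexed form). -/
noncomputable def conjP (f : ℕ → ℕ) : ℕ → ℕ := fun r => Set.ncard {c : ℕ | r + 1 ≤ f c}

/-- The conjugate bipartition `λ′ = ((λ⁽²⁾)′ | (λ⁽¹⁾)′)`. -/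
noncomputable def conjB (lam : Fin 2 → ℕ → ℕ) : Fin 2 → ℕ → ℕ := fun a => conjP (lam (1 - a))

/-- `|λ|` for a partition. -/
noncomputable def psize (f : ℕ → ℕ) : ℕ := Set.ncard {p : ℕ × ℕ | p.2 < f p.1}

/-- `|λ|` for a bipartition. -/
noncomputable def bsize (lam : Fin 2 → ℕ → ℕ) : ℕ := psize (lam 0) + psize (lam 1)

/-- `λ_1 + ⋯ + λ_r`. -/
def psum (f : ℕ → ℕ) (r : ℕ) : ℕ := ∑ j ∈ Finset.range r, f j

/-- The dominance order on bipartitions: `λ ⊵ μ`. -/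
def Dominates (lam mu : Fin 2 → ℕ → ℕ) : Prop :=
  ∀ r : ℕ, psum (mu 0) r ≤ psum (lam 0) r ∧
    psize (mu 0) + psum (mu 1) r ≤ psize (lam 0) + psum (lam 1) r

/-! Single-partition versions (for statement 11). -/

abbrev Node1 := ℕ × ℕ

def Diagram1 (f : ℕ → ℕ) : Set Node1 := {x | x.2 < f x.1}

def IsRemovable1 (f : ℕ → ℕ) (x : Node1) : Prop :=
  x ∈ Diagram1 f ∧ ∃ g, IsPartition g ∧ Diagram1 g = Diagram1 f \ {x}

def IsAddable1 (f : ℕ → ℕ) (x : Node1) : Prop :=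
  x ∉ Diagram1 f ∧ ∃ g, IsPartition g ∧ Diagram1 g = Diagram1 f ∪ {x}

def res1 (e : ℕ) (k : ZMod e) (x : Node1) : ZMod e := (x.2 : ZMod e) - (x.1 : ZMod e) + k

def Rim1 (f : ℕ → ℕ) : Set Node1 := {x | x ∈ Diagram1 f ∧ (x.1 + 1, x.2 + 1) ∉ Diagram1 f}

def Step1 (x y : Node1) : Prop :=
  (y.1 = x.1 ∧ y.2 = x.2 + 1) ∨ (x.1 = y.1 + 1 ∧ y.2 = x.2)

def IsRimHook1 (f : ℕ → ℕ) (H : Finset Node1) : Prop :=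
  H.Nonempty ∧ ↑H ⊆ Rim1 f ∧
    (∃ l : List Node1, l.Chain' Step1 ∧ ∀ x : Node1, x ∈ l ↔ x ∈ H) ∧
    ∃ g, IsPartition g ∧ Diagram1 g = Diagram1 f \ ↑H

/-- An `e`-core: a partition with no rim `e`-hooks. -/
def IsECore (e : ℕ) (f : ℕ → ℕ) : Prop := ¬ ∃ H : Finset Node1, IsRimHook1 f H ∧ H.card = e

/-! The statement. -/

/-- The multipartition obtained from `lam` by setting row `s` of component `b` to `v`. -/
def setRow (lam : Fin 2 → ℕ → ℕ) (b : Fin 2) (s v : ℕ) : Fin 2 → ℕ → ℕ :=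
  fun a t => if a = b ∧ t = s then v else lam a t

theorem setRow_isBipartition {lam : Fin 2 → ℕ → ℕ} (hlam : IsBipartition lam) {b : Fin 2}
    {s v : ℕ} (hlow : lam b (s + 1) ≤ v) (hupp : ∀ t, t + 1 = s → v ≤ lam b t) :
    IsBipartition (setRow lam b s v) := by
  intro a
  obtain ⟨hmono, N, hN⟩ := hlam a
  refine ⟨fun t => ?_, N + s + 1, fun t ht => ?_⟩
  · have := hmono t
    unfold setRow
    split_ifs with h₁ h₂ h₂
    · exact le_rfl
    · obtain ⟨rfl, h⟩ := h₁
      exact hupp t h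
    · obtain ⟨rfl, rfl⟩ := h₂
      exact hlow
    · exact this
  · have : ¬ (a = b ∧ t = s) := by omega
    rw [setRow, if_neg this]
    exact hN t (by omega)

theorem isRemovable_of_lt {lam : Fin 2 → ℕ → ℕ} (hlam : IsBipartition lam) {b : Fin 2}
    {s d : ℕ} (hd : lam b s = d + 1) (hlt : lam b (s + 1) < lam b s) :
    IsRemovable lam (s, d, b) := by
  refine ⟨show d < lam b s by omega, setRow lam b s d,
    setRow_isBipartition hlam (by omega) ?_, ?_⟩
  · rintro t rfl
    have := (hlam b).1 t
    omega
  · ext ⟨t, c, a⟩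
    simp only [Diagram, setRow, Set.mem_ofPred_eq, Set.mem_sdiff, Set.mem_singleton_iff,
      Prod.mk.injEq]
    split_ifs with h
    · obtain ⟨rfl, rfl⟩ := h
      simp only [true_and, and_true]
      omega
    · tauto

theorem isAddable_of_lt {lam : Fin 2 → ℕ → ℕ} (hlam : IsBipartition lam) {b : Fin 2}
    {s : ℕ} (hlt : lam b (s + 1) < lam b s) : IsAddable lam (s + 1, lam b (s + 1), b) := by
  refine ⟨lt_irrefl (lam b (s + 1)), setRow lam b (s + 1) (lam b (s + 1) + 1),
    setRow_isBipartition hlam ?_ ?_, ?_⟩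
  · have := (hlam b).1 (s + 1)
    omega
  · intro t ht
    obtain rfl : t = s := by omega
    omega
  · ext ⟨t, c, a⟩
    simp only [Diagram, setRow, Set.mem_ofPred_eq, Set.mem_union, Set.mem_singleton_iff,
      Prod.mk.injEq]
    split_ifs with h
    · obtain ⟨rfl, rfl⟩ := h
      simp only [true_and, and_true]
      omega
    · tauto

theorem IsAddable.col_eq {lam : Fin 2 → ℕ → ℕ} {s c : ℕ} {b : Fin 2}
    (h : IsAddable lam (s, c, b)) : c = lam b s := by
  obtain ⟨hnot, nu, -, hnu⟩ := h
  have hmem : ∀ d, d < nu b s ↔ d < lam b s ∨ d = c := fun d => by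
    simpa [Diagram, or_comm] using Set.ext_iff.1 hnu (s, d, b)
  have hc : ¬ c < lam b s := hnot
  have h₁ := hmem c
  have h₂ := hmem (lam b s)
  omega

theorem diagram_finite {lam : Fin 2 → ℕ → ℕ} (hlam : IsBipartition lam) :
    (Diagram lam).Finite := by
  choose N hN using fun a => (hlam a).2
  have hsub : Diagram lam ⊆ ⋃ a : Fin 2, ⋃ r ∈ Finset.range (N a),
      (fun c => ((r, c, a) : Node)) '' Set.Iio (lam a r) := by
    rintro ⟨r, c, a⟩ (h : c < lam a r)
    simp only [Set.mem_iUnion]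
    refine ⟨a, r, ?_, c, h, rfl⟩
    by_contra hr
    have := hN a r (by simpa using hr)
    omega
  refine Set.Finite.subset ?_ hsub
  exact Set.finite_iUnion fun a => (Finset.range (N a)).finite_toSet.biUnion
    fun r _ => (Set.finite_Iio _).image _

/-- If the removable end of row `s` has the same residue as the normal node at the end of row
`s + 1`, then it is normal as well. -/
theorem IsNormal.of_row_succ {e : ℕ} (he : 2 ≤ e) {κ : Fin 2 → ZMod e} {lam : Fin 2 → ℕ → ℕ}
    (hlam : IsBipartition lam) {i : ZMod e} {s c d : ℕ} {b : Fin 2}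
    (hx : IsNormal e κ lam i (s + 1, c, b)) (hc : lam b (s + 1) = c + 1)
    (hrem : IsRemovable lam (s, d, b)) (hres : res e κ (s, d, b) = i) :
    IsNormal e κ lam i (s, d, b) := by
  have : Fact (1 < e) := ⟨by omega⟩
  obtain ⟨-, hresx, hnorm⟩ := hx
  have below : ∀ y : Node, IsAddable lam y → res e κ y = i → Above (s, d, b) y →
      Above (s + 1, c, b) y := by
    rintro ⟨t, k, a⟩ hy hyres hab
    rcases hab with hab | ⟨rfl, hst⟩
    · exact Or.inl hab
    · refine Or.inr ⟨rfl, ?_⟩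
      rcases Nat.lt_or_ge (s + 1) t with h | h
      · exact h
      · exfalso
        obtain rfl : t = s + 1 := by
          have : s < t := hst
          omega
        obtain rfl := hy.col_eq
        rw [← hresx] at hyres
        simp [res, hc] at hyres
  have weaken : ∀ z : Node, Above (s + 1, c, b) z → Above (s, d, b) z := by
    rintro z (h | ⟨h₁, h₂⟩)
    · exact Or.inl h
    · exact Or.inr ⟨h₁, (Nat.lt_succ_self s).trans h₂⟩
  refine ⟨hrem, hres, fun y hy hyres hab => ?_⟩
  have hadd : {z : Node | IsAddable lam z ∧ res e κ z = i ∧ Above (s, d, b) z ∧ Above z y} =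
      {z : Node | IsAddable lam z ∧ res e κ z = i ∧ Above (s + 1, c, b) z ∧ Above z y} := by
    ext z
    exact ⟨fun ⟨h₁, h₂, h₃, h₄⟩ => ⟨h₁, h₂, below z h₁ h₂ h₃, h₄⟩,
      fun ⟨h₁, h₂, h₃, h₄⟩ => ⟨h₁, h₂, weaken z h₃, h₄⟩⟩
  rw [hadd]
  refine (hnorm y hy hyres (below y hy hyres hab)).trans_le (Set.ncard_le_ncard ?_ ?_)
  · exact fun z ⟨h₁, h₂, h₃, h₄⟩ => ⟨h₁, h₂, weaken z h₃, h₄⟩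
  · exact (diagram_finite hlam).subset fun z hz => hz.1.1

/-- There is no addable node of the same residue in the row just below a normal node. -/
theorem IsNormal.res_ne_of_isAddable {e : ℕ} {κ : Fin 2 → ZMod e} {lam : Fin 2 → ℕ → ℕ}
    {i : ZMod e} {s c d : ℕ} {b : Fin 2} (hx : IsNormal e κ lam i (s, c, b))
    (hy : IsAddable lam (s + 1, d, b)) : res e κ (s + 1, d, b) ≠ i := by
  intro hres
  have h := hx.2.2 _ hy hres (Or.inr ⟨rfl, Nat.lt_succ_self s⟩)
  have hempty : {z : Node | IsRemovable lam z ∧ res e κ z = i ∧ Above (s, c, b) z ∧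
      Above z (s + 1, d, b)} = ∅ := by
    ext ⟨t, k, a⟩
    simp only [Above, Set.mem_ofPred_eq, Set.mem_empty_iff_false, iff_false]
    omega
  rw [hempty, Set.ncard_empty] at h
  exact Nat.not_lt_zero _ h

theorem stmt3 (e : ℕ) (he : 2 ≤ e) (κ : Fin 2 → ZMod e) (mu lam : Fin 2 → ℕ → ℕ)
    (hlam : IsBipartition lam) (hmu : IsBipartition mu)
    (h : ∃ i : ZMod e, RemGoodAt e κ i mu lam) (a : Fin 2) :
    IsERestricted e (lam a) ↔ IsERestricted e (mu a) := by
  obtain ⟨i, ⟨r, c, b⟩, hgood, hdiag⟩ := h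
  obtain ⟨hnormal, hhighest⟩ := hgood
  have hres := hnormal.2.1
  have hmem : ∀ a t d, d < mu a t ↔ d < lam a t ∧ ¬ (t = r ∧ d = c ∧ a = b) := fun a t d => by
    simpa [Diagram] using Set.ext_iff.1 hdiag (t, d, a)
  have hrow : ∀ a t, ¬ (a = b ∧ t = r) → mu a t = lam a t := fun a t hne => by
    refine eq_of_forall_lt_iff fun d => ?_
    rw [hmem]
    tauto
  have hcmem : c < lam b r := hnormal.1.1
  have hcmu : ¬ c < mu b r := by simp [hmem]
  have hcsucc : ¬ c + 1 < lam b r := fun hlt => by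
    have := (hmem b r (c + 1)).2 ⟨hlt, by omega⟩
    omega
  have hlamr : lam b r = c + 1 := by omega
  have hmur : mu b r = c := by
    rcases Nat.eq_zero_or_pos c with h0 | h0
    · omega
    · have := (hmem b r (c - 1)).2 ⟨by omega, by omega⟩
      omega
  by_cases hab : a = b
  swap
  · have : mu a = lam a := funext fun t => hrow a t (by tauto)
    rw [this]
  subst hab
  have hbelow := hrow a (r + 1) (by omega)
  have hmubelow := (hmu a).1 r
  constructor
  · intro hlamres t
    have ht := hlamres t
    rcases eq_or_ne t r with rfl | htr
    · omega
    rw [hrow a t (by tauto)]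
    by_cases hts : t + 1 = r
    swap
    · rwa [hrow a (t + 1) (by tauto)]
    subst hts
    rw [hmur]
    by_contra hcon
    obtain ⟨d, hd⟩ : ∃ d, lam a t = d + 1 := ⟨lam a t - 1, by omega⟩
    have hdc : d + 1 = c + e := by omega
    have hdres : res e κ (t, d, a) = i := by
      rw [← hres]
      have := congrArg (Nat.cast : ℕ → ZMod e) hdc
      push_cast [CharP.cast_eq_zero] at this
      simp only [res]
      push_cast
      linear_combination this
    have hd_normal := hnormal.of_row_succ he hlam hlamr
      (isRemovable_of_lt hlam hd (by omega)) hdres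
    rcases hhighest _ hd_normal with heq | habove
    · simp at heq
    · simp only [Above] at habove
      omega
  · intro hmures t
    have ht := hmures t
    rcases eq_or_ne t r with rfl | htr
    · by_contra hcon
      refine hnormal.res_ne_of_isAddable (isAddable_of_lt hlam (by omega)) ?_
      rw [← hres]
      have hce : c + 1 = lam a (t + 1) + e := by omega
      have := congrArg (Nat.cast : ℕ → ZMod e) hce
      push_cast [CharP.cast_eq_zero] at this
      simp only [res]
      push_cast
      linear_combination -this
    · rw [hrow a t (by tauto)] at ht
      by_cases hts : t + 1 = r
      · subst hts
        omega
      · rwa [hrow a (t + 1) (by tauto)] at ht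

end Wt3
end

section
/- Fix an integer e ≥ 2 and κ = (κ₁, κ₂) ∈ (ℤ/eℤ)². Suppose λ is a bipartition and λ⁻ is a bipartition obtained from λ by removing a rim e-hook (that is, [λ⁻] = [λ] ∖ H for some rim hook H of λ with exactly e nodes). Then wt(λ⁻) = wt(λ) − 2. -/
namespace Wt3

theorem IsPartition.le_zero {f : ℕ → ℕ} (hf : IsPartition f) (r : ℕ) : f r ≤ f 0 :=
  antitone_nat_of_succ_le hf.1 (Nat.zero_le r)

theorem IsBipartition.finite_diagram {lam : Fin 2 → ℕ → ℕ} (h : IsBipartition lam) :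
    (Diagram lam).Finite := by
  obtain ⟨N₀, h₀⟩ := (h 0).2
  obtain ⟨N₁, h₁⟩ := (h 1).2
  refine ((Set.finite_Iio (max N₀ N₁)).prod
    ((Set.finite_Iio (max (lam 0 0) (lam 1 0))).prod (Set.finite_univ (α := Fin 2)))).subset ?_
  rintro ⟨r, c, a⟩ hx
  replace hx : c < lam a r := hx
  have hle := (h a).le_zero r
  simp only [Set.mem_prod, Set.mem_Iio, Set.mem_univ, and_true]
  fin_cases a
  · have := h₀ r
    simp only [Fin.zero_eta] at hx hle
    omega
  · have := h₁ r
    simp only [Fin.mk_one] at hx hle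
    omega

theorem Step.content_eq {x y : Node} (h : Step x y) :
    (y.2.1 : ℤ) - y.1 = (x.2.1 : ℤ) - x.1 + 1 := by
  obtain ⟨-, ⟨h₁, h₂⟩ | ⟨h₁, h₂⟩⟩ := h <;> omega

/-- The contents along a strip are consecutive integers. -/
theorem content_getElem {l : List Node} (hl : l.IsChain Step) (n : ℕ) (hn : n < l.length) :
    (l[n].2.1 : ℤ) - l[n].1 = (l[0].2.1 : ℤ) - l[0].1 + n := by
  induction n with
  | zero => simp
  | succ n ih =>
    have hstep := (List.isChain_iff_getElem.mp hl n hn).content_eq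
    rw [hstep, ih (by omega)]
    push_cast
    ring

theorem res_eq_intCast (e : ℕ) (κ : Fin 2 → ZMod e) (x : Node) :
    res e κ x = (((x.2.1 : ℤ) - x.1 : ℤ) : ZMod e) + κ x.2.2 := by
  simp [res]

/-- A rim `e`-hook contains exactly one node of each residue. -/
theorem IsRimHook.existsUnique_res {e : ℕ} (he : e ≠ 0) (κ : Fin 2 → ZMod e)
    {lam : Fin 2 → ℕ → ℕ} {H : Finset Node} (hH : IsRimHook lam H) (hcard : H.card = e)
    (i : ZMod e) : ∃! x, x ∈ H ∧ res e κ x = i := by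
  obtain ⟨-, -, hcomp, ⟨l, hl, hlH⟩, -⟩ := hH
  have hnd : l.Nodup := by
    rw [List.nodup_iff_injective_getElem]
    rintro ⟨m, hm⟩ ⟨n, hn⟩ hmn
    have h₁ := content_getElem hl m hm
    have h₂ := content_getElem hl n hn
    simp only at hmn
    rw [hmn] at h₁
    ext
    simp only
    omega
  have hlen : l.length = e := by
    rw [← hcard, ← List.toFinset_card_of_nodup hnd]
    congr 1
    ext x
    simp [hlH]
  have : NeZero e := ⟨he⟩
  have hinj : Set.InjOn (res e κ) H := by
    intro x hx y hy hxy
    have hc := hcomp x hx y hy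
    obtain ⟨m, hm, rfl⟩ := List.mem_iff_getElem.mp ((hlH x).mpr hx)
    obtain ⟨n, hn, rfl⟩ := List.mem_iff_getElem.mp ((hlH y).mpr hy)
    rw [res_eq_intCast, res_eq_intCast, hc, content_getElem hl m hm, content_getElem hl n hn] at hxy
    have hmn : (m : ZMod e) = n := by simpa using hxy
    have : m = n := by
      rw [ZMod.natCast_eq_natCast_iff'] at hmn
      rwa [Nat.mod_eq_of_lt (by omega), Nat.mod_eq_of_lt (by omega)] at hmn
    subst this
    rfl
  have himage : H.image (res e κ) = Finset.univ := by
    apply Finset.eq_univ_of_card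
    rw [Finset.card_image_of_injOn hinj, hcard, ZMod.card]
  have hi : i ∈ H.image (res e κ) := himage ▸ Finset.mem_univ i
  obtain ⟨x, hx, hxi⟩ := Finset.mem_image.mp hi
  exact ⟨x, ⟨hx, hxi⟩, fun y hy => hinj hy.1 hx (hy.2.trans hxi.symm)⟩

/-- Removing a rim `e`-hook removes exactly one node of each residue. -/
theorem cnt_add_one_of_isRimHook {e : ℕ} (he : e ≠ 0) (κ : Fin 2 → ZMod e)
    {lam mu : Fin 2 → ℕ → ℕ} (hlam : IsBipartition lam) {H : Finset Node}
    (hH : IsRimHook lam H) (hcard : H.card = e) (hmu : Diagram mu = Diagram lam \ ↑H)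
    (i : ZMod e) : cnt e κ mu i + 1 = cnt e κ lam i := by
  obtain ⟨x, ⟨hx, hxi⟩, huniq⟩ := hH.existsUnique_res he κ hcard i
  have hxlam : x ∈ Diagram lam := (hH.2.1 hx).1
  have hset : {y : Node | y ∈ Diagram mu ∧ res e κ y = i} =
      {y : Node | y ∈ Diagram lam ∧ res e κ y = i} \ {x} := by
    ext y
    simp only [hmu, Set.mem_ofPred_eq, Set.mem_sdiff, Finset.mem_coe, Set.mem_singleton_iff]
    constructor
    · rintro ⟨⟨hy, hyH⟩, hyi⟩
      exact ⟨⟨hy, hyi⟩, fun h => hyH (h ▸ hx)⟩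
    · rintro ⟨⟨hy, hyi⟩, hne⟩
      exact ⟨⟨hy, fun hyH => hne (huniq y ⟨hyH, hyi⟩)⟩, hyi⟩
  rw [cnt, cnt, hset]
  exact Set.ncard_sdiff_singleton_add_one ⟨hxlam, hxi⟩
    (hlam.finite_diagram.subset fun y hy => hy.1)

/-! The statement. -/

theorem stmt7 (e : ℕ) (he : 2 ≤ e) (κ : Fin 2 → ZMod e) (lam lamminus : Fin 2 → ℕ → ℕ)
    (hlam : IsBipartition lam) (hlamminus : IsBipartition lamminus)
    (h : ∃ H : Finset Node, IsRimHook lam H ∧ H.card = e ∧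
      Diagram lamminus = Diagram lam \ ↑H) :
    wt e κ lamminus = wt e κ lam - 2 := by
  obtain ⟨H, hH, hcard, hmu⟩ := h
  have hcnt (i : ZMod e) : (cnt e κ lam i : ℚ) = cnt e κ lamminus i + 1 := by
    exact_mod_cast (cnt_add_one_of_isRimHook (by omega) κ hlam hH hcard hmu i).symm
  simp only [wt, hcnt, add_sub_add_right_eq_sub]
  ring

end Wt3
end
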